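/- arXiv:1802.08656 — 3 statements merged into one kernel-verified Lean document; each statement's English description precedes it below -/
import Mathlib

section
/- (Uniqueness of triangular subset-sum solutions.) Let U be a set equipped with a total preorder ≼ (reflexive and transitive, with any two elements comparable), let V be a set, and for each v ∈ V let F_v : U → ℕ be a finitely supported function. Assume the triangular condition: there is an injective map τ : V → U such that for every v ∈ V, F_v(τ(v)) > 0 and every u in the support of F_v with u ≠ τ(v) satisfies τ(v) ≼ u and not u ≼ τ(v). Then for every finitely supported K : U → ℕ there is at most one finitely supported L : V → ℕ satisfying Σ_{v ∈ V} L(v)·F_v(u) = K(u) for all u ∈ U. -/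
/-- A nonempty finite set has a least element for any total preorder pulled back along `f`. -/
theorem Finset.Nonempty.exists_least_of_total {α β : Type*} {r : β → β → Prop}
    (htrans : ∀ a b c, r a b → r b c → r a c) (htotal : ∀ a b, r a b ∨ r b a)
    (f : α → β) {s : Finset α} (hs : s.Nonempty) :
    ∃ a ∈ s, ∀ b ∈ s, r (f a) (f b) := by
  induction hs using Finset.Nonempty.cons_induction with
  | singleton a => exact ⟨a, by simp, by simpa using htotal (f a) (f a)⟩
  | cons a s ha hs ih =>
    obtain ⟨m, hm, hmin⟩ := ih
    rcases htotal (f a) (f m) with h | h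
    · refine ⟨a, Finset.mem_cons_self a s, fun b hb => ?_⟩
      rcases Finset.mem_cons.1 hb with rfl | hb
      · simpa using htotal (f b) (f b)
      · exact htrans _ _ _ h (hmin b hb)
    · refine ⟨m, Finset.mem_cons_of_mem hm, fun b hb => ?_⟩
      rcases Finset.mem_cons.1 hb with rfl | hb
      · exact h
      · exact hmin b hb

/-- **Uniqueness of triangular subset-sum solutions.** Let `U` carry a total preorder
`≼`, let `V` be a set, and for each `v ∈ V` let `F_v : U → ℕ` be finitely supported.
Assume the triangular condition: there is an injective `τ : V → U` such that
`F_v(τ v) > 0` and every `u` in the support of `F_v` with `u ≠ τ v` satisfies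
`τ v ≼ u` and `¬ u ≼ τ v`. Then for every finitely supported `K : U → ℕ` there is at
most one finitely supported `L : V → ℕ` with `Σ_v L(v)·F_v(u) = K(u)` for all `u`. -/
theorem triangular_subset_sum_unique
    {U V : Type*} (pre : U → U → Prop)
    (hrefl : ∀ u, pre u u)
    (htrans : ∀ a b c, pre a b → pre b c → pre a c)
    (htotal : ∀ a b, pre a b ∨ pre b a)
    (F : V → U → ℕ) (hFfin : ∀ v, (Function.support (F v)).Finite)
    (τ : V → U) (hτinj : Function.Injective τ)
    (hτpos : ∀ v, 0 < F v (τ v))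
    (hτmin : ∀ v u, 0 < F v u → u ≠ τ v → pre (τ v) u ∧ ¬ pre u (τ v))
    (K : U → ℕ) (hKfin : (Function.support K).Finite)
    (L₁ L₂ : V → ℕ)
    (hL₁fin : (Function.support L₁).Finite) (hL₂fin : (Function.support L₂).Finite)
    (h₁ : ∀ u, ∑ᶠ v, L₁ v * F v u = K u)
    (h₂ : ∀ u, ∑ᶠ v, L₂ v * F v u = K u) :
    L₁ = L₂ := by
  classical
  let S : Finset V := hL₁fin.toFinset ∪ hL₂fin.toFinset
  have hsum : ∀ u, ∑ v ∈ S, L₁ v * F v u = ∑ v ∈ S, L₂ v * F v u := by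
    intro u
    rw [← finsum_eq_sum_of_support_subset, ← finsum_eq_sum_of_support_subset, h₁, h₂]
    · intro v hv
      simp_all [S]
    · intro v hv
      simp_all [S]
  by_contra hne
  obtain ⟨x, hx⟩ := Function.ne_iff.1 hne
  have hmemS : ∀ v, L₁ v ≠ L₂ v → v ∈ S := by
    intro v hv
    simp only [S, Finset.mem_union, Set.Finite.mem_toFinset, Function.mem_support]
    lia
  have hD : (S.filter fun v => L₁ v ≠ L₂ v).Nonempty :=
    ⟨x, Finset.mem_filter.2 ⟨hmemS x hx, hx⟩⟩
  obtain ⟨v, hv, hmin⟩ := hD.exists_least_of_total htrans htotal τ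
  obtain ⟨hvS, hvne⟩ := Finset.mem_filter.1 hv
  have hrest : ∑ w ∈ S.erase v, L₁ w * F w (τ v) = ∑ w ∈ S.erase v, L₂ w * F w (τ v) := by
    refine Finset.sum_congr rfl fun w hw => ?_
    obtain ⟨hwv, hwS⟩ := Finset.mem_erase.1 hw
    rcases Nat.eq_zero_or_pos (F w (τ v)) with h0 | hpos
    · simp [h0]
    · have hlt := (hτmin w (τ v) hpos (hτinj.ne hwv.symm)).2
      have : L₁ w = L₂ w := by
        by_contra h
        exact hlt (hmin w (Finset.mem_filter.2 ⟨hwS, h⟩))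
      rw [this]
  have hv_sum := hsum (τ v)
  rw [← Finset.add_sum_erase S _ hvS, ← Finset.add_sum_erase S _ hvS, hrest] at hv_sum
  exact hvne (Nat.eq_of_mul_eq_mul_right (hτpos v) (Nat.add_right_cancel hv_sum))
end

section
/- Let M ≤ G be groups, let ψ : M → Sym(Ω) be a homomorphism with Ω finite, and suppose φ : G → Sym(Ω) extends ψ. Then C_{Sym(Ω)}(φ(G)) ≤ C_{Sym(Ω)}(ψ(M)), and the set of homomorphisms φ' : G → Sym(Ω) that extend ψ and are equivalent to φ as permutation actions is in bijection with the set of cosets of C_{Sym(Ω)}(φ(G)) in C_{Sym(Ω)}(ψ(M)); explicitly, the coset of λ ∈ C_{Sym(Ω)}(ψ(M)) corresponds to the homomorphism φ^λ defined by φ^λ(g) = λ⁻¹ φ(g) λ. In particular, the number of extensions of ψ equivalent to φ equals the index [C_{Sym(Ω)}(ψ(M)) : C_{Sym(Ω)}(φ(G))]. -/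
namespace MonoidHom

variable {G H : Type*} [Group G] [Group H]

theorem centralizer_range_le_of_extends {M : Subgroup G} {ψ : M →* H} {φ : G →* H}
    (hext : ∀ m : M, φ m = ψ m) :
    Subgroup.centralizer (Set.range (fun g : G => φ g)) ≤
      Subgroup.centralizer (Set.range (fun m : M => ψ m)) := by
  apply Subgroup.centralizer_le
  rintro _ ⟨m, rfl⟩
  exact ⟨m, hext m⟩

theorem inv_mul_mul_eq_iff_commute (l x : H) : l⁻¹ * x * l = x ↔ x * l = l * x := by
  rw [mul_assoc, inv_mul_eq_iff_eq_mul]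

theorem mem_centralizer_range_iff (φ : G →* H) (l : H) :
    l ∈ Subgroup.centralizer (Set.range (fun g : G => φ g)) ↔
      ∀ g, l⁻¹ * φ g * l = φ g := by
  simp only [Subgroup.mem_centralizer_iff, Set.forall_mem_range, inv_mul_mul_eq_iff_commute]

theorem conj_eq_conj_iff (φ : G →* H) (k l : H) :
    (∀ g, k⁻¹ * φ g * k = l⁻¹ * φ g * l) ↔
      l * k⁻¹ ∈ Subgroup.centralizer (Set.range (fun g : G => φ g)) := by
  rw [mem_centralizer_range_iff]
  refine forall_congr' fun g => ?_
  rw [eq_comm, ← (MulAut.conj k).injective.eq_iff]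
  simp [mul_assoc]

/-- Right cosets of the centralizer of `φ` in the centralizer of `ψ` parametrize the
homomorphisms that extend `ψ` and are conjugate to `φ`. -/
theorem exists_equiv_extensions_conj {M : Subgroup G} {ψ : M →* H} {φ : G →* H}
    (hext : ∀ m : M, φ m = ψ m) :
    ∃ e : Quotient (QuotientGroup.rightRel
        ((Subgroup.centralizer (Set.range (fun g : G => φ g))).subgroupOf
          (Subgroup.centralizer (Set.range (fun m : M => ψ m))))) ≃
        {φ' : G →* H // (∀ m : M, φ' m = ψ m) ∧ ∃ l : H, ∀ g : G, φ' g = l⁻¹ * φ g * l},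
      ∀ (l : Subgroup.centralizer (Set.range (fun m : M => ψ m))) (g : G),
        (e (Quotient.mk'' l)).1 g = (l : H)⁻¹ * φ g * (l : H) := by
  let f (l : Subgroup.centralizer (Set.range (fun m : M => ψ m))) :
      {φ' : G →* H // (∀ m : M, φ' m = ψ m) ∧ ∃ l : H, ∀ g : G, φ' g = l⁻¹ * φ g * l} :=
    ⟨(MulAut.conj (l : H)⁻¹).toMonoidHom.comp φ,
      fun m => by simpa [hext] using (mem_centralizer_range_iff ψ l).1 l.2 m,
      l, fun g => by simp⟩
  have hf (l) (g : G) : (f l).1 g = (l : H)⁻¹ * φ g * (l : H) := by simp [f]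
  have hrel (k l) : f k = f l ↔ QuotientGroup.rightRel
      ((Subgroup.centralizer (Set.range (fun g : G => φ g))).subgroupOf
        (Subgroup.centralizer (Set.range (fun m : M => ψ m)))) k l := by
    rw [QuotientGroup.rightRel_apply, Subgroup.mem_subgroupOf, Subtype.ext_iff,
      MonoidHom.ext_iff]
    simp only [hf]
    exact conj_eq_conj_iff φ k l
  refine ⟨Equiv.ofBijective (Quotient.lift f fun k l h => (hrel k l).2 h) ⟨?_, ?_⟩, hf⟩
  · rintro ⟨k⟩ ⟨l⟩ h
    exact Quotient.sound ((hrel k l).1 h)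
  · rintro ⟨φ', hφ', l, hl⟩
    have hmem : l ∈ Subgroup.centralizer (Set.range (fun m : M => ψ m)) :=
      (mem_centralizer_range_iff ψ l).2 fun m => by rw [← hext, ← hl, hφ', hext]
    refine ⟨Quotient.mk'' ⟨l, hmem⟩, Subtype.ext (MonoidHom.ext fun g => ?_)⟩
    exact (hf ⟨l, hmem⟩ g).trans (hl g).symm

end MonoidHom


/-- Let `M ≤ G`, `Ω` finite, let `ψ : M → Sym(Ω)` be a homomorphism and suppose
`φ : G → Sym(Ω)` extends `ψ`. Then `C_{Sym(Ω)}(φ(G)) ≤ C_{Sym(Ω)}(ψ(M))`, and the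
set of homomorphisms `φ' : G → Sym(Ω)` extending `ψ` and equivalent to `φ` is in
bijection with the right cosets of `C_{Sym(Ω)}(φ(G))` in `C_{Sym(Ω)}(ψ(M))`, the
coset of `λ` corresponding to `φ^λ : g ↦ λ⁻¹ φ(g) λ`. In particular the number of
such extensions equals the index `[C_{Sym(Ω)}(ψ(M)) : C_{Sym(Ω)}(φ(G))]`. -/
theorem extensions_equivalent_biject_with_centralizer_cosets
    {G Ω : Type*} [Group G] [Fintype Ω] (M : Subgroup G)
    (ψ : ↥M →* Equiv.Perm Ω) (φ : G →* Equiv.Perm Ω)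
    (hext : ∀ m : ↥M, φ (m : G) = ψ m) :
    Subgroup.centralizer (Set.range (fun g : G => φ g)) ≤
      Subgroup.centralizer (Set.range (fun m : ↥M => ψ m)) ∧
    (∃ e : Quotient (QuotientGroup.rightRel
        ((Subgroup.centralizer (Set.range (fun g : G => φ g))).subgroupOf
          (Subgroup.centralizer (Set.range (fun m : ↥M => ψ m))))) ≃
        {φ' : G →* Equiv.Perm Ω //
          (∀ m : ↥M, φ' (m : G) = ψ m) ∧
          ∃ l : Equiv.Perm Ω, ∀ g : G, φ' g = l⁻¹ * φ g * l},
      ∀ (l : ↥(Subgroup.centralizer (Set.range (fun m : ↥M => ψ m)))) (g : G),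
        (e (Quotient.mk'' l)).1 g = (l : Equiv.Perm Ω)⁻¹ * φ g * (l : Equiv.Perm Ω)) ∧
    Nat.card {φ' : G →* Equiv.Perm Ω //
        (∀ m : ↥M, φ' (m : G) = ψ m) ∧
        ∃ l : Equiv.Perm Ω, ∀ g : G, φ' g = l⁻¹ * φ g * l} =
      ((Subgroup.centralizer (Set.range (fun g : G => φ g))).subgroupOf
        (Subgroup.centralizer (Set.range (fun m : ↥M => ψ m)))).index := by
  obtain ⟨e, he⟩ := MonoidHom.exists_equiv_extensions_conj hext
  refine ⟨MonoidHom.centralizer_range_le_of_extends hext, ⟨e, he⟩, ?_⟩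
  exact Nat.card_congr
    (e.symm.trans (QuotientGroup.quotientRightRelEquivQuotientLeftRel _))
end

section
/- Let Σ, Γ ⊆ {1,…,n} be disjoint subsets with |Σ| + |Γ| ≤ n − 2. Suppose L, M are subgroups of the alternating group A_n satisfying (A_n)_(Σ) ≤ L ≤ (A_n)_Σ and (A_n)_(Γ) ≤ M ≤ (A_n)_Γ. Then the permutation group induced by L on Σ equals the permutation group induced by L ∩ M on Σ, i.e., L^Σ = (L ∩ M)^Σ as subgroups of Sym(Σ). -/
/-- A permutation preserving `S` agrees on `S` with an even permutation that moves, outside `S`,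
at most the two given points `a ≠ b`. -/
theorem exists_mem_alternatingGroup_eqOn {α : Type*} [Fintype α] [DecidableEq α]
    (S : Finset α) (g : Equiv.Perm α) (hg : ∀ x, x ∈ S ↔ g x ∈ S)
    {a b : α} (hab : a ≠ b) (ha : a ∉ S) (hb : b ∉ S) :
    ∃ h ∈ alternatingGroup α, (∀ x ∈ S, h x = g x) ∧
      ∀ x ∉ S, x ≠ a → x ≠ b → h x = x := by
  let s : Equiv.Perm α := Equiv.Perm.ofSubtype (g.subtypePerm (p := (· ∈ S)) fun x => (hg x).symm)
  have hs : ∀ x ∈ S, s x = g x := fun x hx => by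
    simp [s, Equiv.Perm.ofSubtype_apply_of_mem _ hx]
  have hs' : ∀ x ∉ S, s x = x := fun x hx => Equiv.Perm.ofSubtype_apply_of_not_mem _ hx
  rcases Int.units_eq_one_or (Equiv.Perm.sign s) with h1 | h1
  · exact ⟨s, Equiv.Perm.mem_alternatingGroup.2 h1, hs, fun x hx _ _ => hs' x hx⟩
  · refine ⟨s * Equiv.swap a b, Equiv.Perm.mem_alternatingGroup.2 ?_, fun x hx => ?_,
      fun x hx hxa hxb => ?_⟩
    · simp [h1, Equiv.Perm.sign_swap hab]
    · rw [Equiv.Perm.mul_apply, Equiv.swap_apply_of_ne_of_ne (ne_of_mem_of_not_mem hx ha)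
        (ne_of_mem_of_not_mem hx hb), hs x hx]
    · rw [Equiv.Perm.mul_apply, Equiv.swap_apply_of_ne_of_ne hxa hxb, hs' x hx]


/-- Let `Σ, Γ ⊆ {1,…,n}` be disjoint with `|Σ| + |Γ| ≤ n - 2`. If `L, M ≤ A_n`
satisfy `(A_n)_(Σ) ≤ L ≤ (A_n)_Σ` and `(A_n)_(Γ) ≤ M ≤ (A_n)_Γ`, then the
permutation group induced by `L` on `Σ` equals that induced by `L ∩ M` on `Σ`:
every element of `L` agrees on `Σ` with some element of `L ∩ M`, and conversely. -/
theorem induced_group_eq_of_inter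
    (n : ℕ) (S Γ : Finset (Fin n)) (hdisj : Disjoint S Γ)
    (hcard : S.card + Γ.card ≤ n - 2)
    (L M : Subgroup ↥(alternatingGroup (Fin n)))
    (hptL : ∀ g : ↥(alternatingGroup (Fin n)),
      (∀ x ∈ S, (g : Equiv.Perm (Fin n)) x = x) → g ∈ L)
    (hsetL : ∀ g ∈ L, ∀ x : Fin n, x ∈ S ↔ (g : Equiv.Perm (Fin n)) x ∈ S)
    (hptM : ∀ g : ↥(alternatingGroup (Fin n)),
      (∀ x ∈ Γ, (g : Equiv.Perm (Fin n)) x = x) → g ∈ M)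
    (hsetM : ∀ g ∈ M, ∀ x : Fin n, x ∈ Γ ↔ (g : Equiv.Perm (Fin n)) x ∈ Γ) :
    (∀ g ∈ L, ∃ h ∈ L ⊓ M, ∀ x ∈ S,
      (g : Equiv.Perm (Fin n)) x = (h : Equiv.Perm (Fin n)) x) ∧
    (∀ h ∈ L ⊓ M, ∃ g ∈ L, ∀ x ∈ S,
      (h : Equiv.Perm (Fin n)) x = (g : Equiv.Perm (Fin n)) x) := by
  refine ⟨fun g hg => ?_, fun h hh => ⟨h, hh.1, fun _ _ => rfl⟩⟩
  rcases Nat.lt_or_ge n 2 with hn | hn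
  · have : Subsingleton (Fin n) := Fin.subsingleton_iff_le_one.2 (by omega)
    exact ⟨1, one_mem _, fun _ _ => Subsingleton.elim _ _⟩
  have hc : 1 < (S ∪ Γ)ᶜ.card := by
    rw [Finset.card_compl, Fintype.card_fin, Finset.card_union_of_disjoint hdisj]
    omega
  obtain ⟨a, ha, b, hb, hab⟩ := Finset.one_lt_card.1 hc
  simp only [Finset.mem_compl, Finset.mem_union, not_or] at ha hb
  obtain ⟨h, hA, hS, hfix⟩ :=
    exists_mem_alternatingGroup_eqOn S (g : Equiv.Perm (Fin n)) (hsetL g hg) hab ha.1 hb.1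
  refine ⟨⟨h, hA⟩, Subgroup.mem_inf.2 ⟨?_, hptM _ fun x hx => ?_⟩, fun x hx => (hS x hx).symm⟩
  · refine (Subgroup.mul_mem_cancel_left L (L.inv_mem hg)).1 ?_
    refine hptL _ fun x hx => ?_
    simp [hS x hx]
  · exact hfix x (Finset.disjoint_right.1 hdisj hx) (ne_of_mem_of_not_mem hx ha.2)
      (ne_of_mem_of_not_mem hx hb.2)
end
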